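/- (Proposition 3.4, operator form: the Gabor matrix of a composition is the product of the Gabor matrices.) Let T₁, T₂ : 𝓢(ℝ^d) → L²(ℝ^d) be linear maps such that for every v ∈ 𝓢(ℝ^d) and i ∈ {1,2} there is C(v,i) with |(v, T_iφ)_{L²}| ≤ C(v,i)‖φ‖_{L²} for all φ ∈ 𝓢(ℝ^d). For α̃ ∈ Γ̃ let T₁*G^A_{α̃} denote the unique element u ∈ L²(ℝ^d) (given by the Riesz representation theorem) with (u, φ)_{L²} = (G^A_{α̃}, T₁φ)_{L²} for all φ ∈ 𝓢(ℝ^d). Then for all α̃, β̃ ∈ Γ̃ the series ∑_{γ̃∈Γ̃} (G^A_{α̃}, T₁G^A_{γ̃})_{L²} (G^A_{γ̃}, T₂G^A_{β̃})_{L²} converges absolutely and equals (T₁*G^A_{α̃}, T₂G^A_{β̃})_{L²}. -/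

import Mathlib

open MeasureTheory Complex
open scoped BigOperators ComplexConjugate ComplexInnerProductSpace

noncomputable section

/-- Euclidean dot product on `ℝ^d` (realized as `Fin d → ℝ`). -/
def dotR {d : ℕ} (x y : Fin d → ℝ) : ℝ := ∑ i, x i * y i

/-- Japanese bracket `⟨x⟩ = (1+|x|²)^(1/2)` (Euclidean norm). -/
def jap {d : ℕ} (x : Fin d → ℝ) : ℝ := Real.sqrt (1 + dotR x x)

/-- Euclidean norm on `ℝ^d`. -/
def enr {d : ℕ} (x : Fin d → ℝ) : ℝ := Real.sqrt (dotR x x)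

/-- Embedding of the lattice `ℤ^d` into `ℝ^d`. -/
def zToR {d : ℕ} (γ : Fin d → ℤ) : Fin d → ℝ := fun i => (γ i : ℝ)

/-- The point `2πk` of the dual lattice `(2πℤ)^d`, for `k ∈ ℤ^d`. -/
def dualV {d : ℕ} (k : Fin d → ℤ) : Fin d → ℝ := fun i => 2 * Real.pi * (k i : ℝ)

/-- The magnetic phase `Λ^A(x,y) = exp(−i ∫₀¹ ⟨A(x+t(y−x)), y−x⟩ dt)`. -/
def magPhase {d : ℕ} (A : (Fin d → ℝ) → (Fin d → ℝ)) (x y : Fin d → ℝ) : ℂ :=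
  Complex.exp (-Complex.I *
    ((∫ t in (0:ℝ)..1, dotR (A (x + t • (y - x))) (y - x)) : ℝ))

/-- The magnetic Gabor frame function
`G^A_{γ,γ*}(x) = Λ^A(x,γ) θ_{γ*}(x−γ) g(x−γ)` with `γ* = 2πk`. -/
def gaborF {d : ℕ} (A : (Fin d → ℝ) → (Fin d → ℝ)) (g : (Fin d → ℝ) → ℝ)
    (γ k : Fin d → ℤ) (x : Fin d → ℝ) : ℂ :=
  magPhase A x (zToR γ) * (((2 * Real.pi) ^ (-(d : ℝ) / 2) : ℝ) : ℂ) *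
    Complex.exp (Complex.I * ((dotR (dualV k) (x - zToR γ) / (2 * Real.pi) : ℝ) : ℂ)) *
    ((g (x - zToR γ) : ℝ) : ℂ)

/-- `g` is a smooth `[0,1]`-valued quadratic partition of unity with support in `(−1,1)^d`. -/
def IsQuadPartition {d : ℕ} (g : (Fin d → ℝ) → ℝ) : Prop :=
  ContDiff ℝ (⊤ : ℕ∞) g ∧ (∀ x, g x ∈ Set.Icc (0:ℝ) 1) ∧
    tsupport g ⊆ Set.univ.pi (fun _ : Fin d => Set.Ioo (-1:ℝ) 1) ∧
    ∀ x, HasSum (fun γ : Fin d → ℤ => (g (x - zToR γ)) ^ 2) 1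

/-- Iterated directional derivative along a list of directions. -/
def dList {E F : Type*} [NormedAddCommGroup E] [NormedSpace ℝ E]
    [NormedAddCommGroup F] [NormedSpace ℝ F] : List E → (E → F) → (E → F)
  | [], f => f
  | v :: L, f => fun x => fderiv ℝ (dList L f) x v

/-- Direction of differentiation in the first (position) variable. -/
def dirX {d : ℕ} (j : Fin d) : (Fin d → ℝ) × (Fin d → ℝ) := (Pi.single j 1, 0)

/-- Direction of differentiation in the second (momentum) variable. -/
def dirXi {d : ℕ} (j : Fin d) : (Fin d → ℝ) × (Fin d → ℝ) := (0, Pi.single j 1)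

/-- The Hörmander class `S^p_0(ℝ^{2d})`. -/
def HormClass (d : ℕ) (p : ℝ) (Φ : ((Fin d → ℝ) × (Fin d → ℝ)) → ℂ) : Prop :=
  ContDiff ℝ (⊤ : ℕ∞) Φ ∧
    ∀ a b : List (Fin d), ∃ C : ℝ,
      ∀ x ξ : Fin d → ℝ,
        ‖dList (a.map dirX ++ b.map dirXi) Φ (x, ξ)‖ ≤ C * jap ξ ^ p

/-- The magnetic field `B_{jk} = ∂_j A_k − ∂_k A_j` of a vector potential `A`. -/
def Bof {d : ℕ} (A : (Fin d → ℝ) → (Fin d → ℝ)) (j k : Fin d) (x : Fin d → ℝ) : ℝ :=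
  fderiv ℝ A x (Pi.single j 1) k - fderiv ℝ A x (Pi.single k 1) j

/-- Each component `B j k` is bounded together with all its partial derivatives. -/
def BBounded {d : ℕ} (B : Fin d → Fin d → (Fin d → ℝ) → ℝ) : Prop :=
  ∀ j k : Fin d, ∀ L : List (Fin d), ∃ C : ℝ,
    ∀ x, ‖dList (L.map (fun i => Pi.single i (1:ℝ))) (B j k) x‖ ≤ C

/-- Flux of `B` through the triangle with vertices `a, b, c`. -/
def fluxB {d : ℕ} (B : Fin d → Fin d → (Fin d → ℝ) → ℝ) (a b c : Fin d → ℝ) : ℝ :=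
  ∫ t in (0:ℝ)..1, ∫ s in (0:ℝ)..1,
    ∑ j, ∑ k, B j k (a + t • (b - a) + (s * t) • (c - b)) *
      ((b - a) j + s * (c - b) j) * (t * (c - b) k)

/-- `Ω^B(a,b,c) = exp(−i ∫_{⟨a,b,c⟩} B)`. -/
def OmegaB {d : ℕ} (B : Fin d → Fin d → (Fin d → ℝ) → ℝ) (a b c : Fin d → ℝ) : ℂ :=
  Complex.exp (-Complex.I * (fluxB B a b c : ℝ))

/-- Polarized form of Parseval's identity for a Parseval frame `e` of an inner product space. -/
theorem hasSum_inner_mul_inner_of_parseval {E ι : Type*} [NormedAddCommGroup E]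
    [InnerProductSpace ℂ E] {e : ι → E}
    (he : ∀ f : E, HasSum (fun i => ‖(⟪e i, f⟫ : ℂ)‖ ^ 2) (‖f‖ ^ 2)) (x y : E) :
    HasSum (fun i => (⟪x, e i⟫ : ℂ) * ⟪e i, y⟫) ⟪x, y⟫ := by
  have h (f : E) : HasSum (fun i => ((‖(⟪e i, f⟫ : ℂ)‖ : ℝ) : ℂ) ^ 2) (((‖f‖ : ℝ) : ℂ) ^ 2) := by
    exact_mod_cast Complex.hasSum_ofReal.mpr (he f)
  rw [inner_eq_sum_norm_sq_div_four x y]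
  convert! (((h (x + y)).sub (h (x - y))).add
    (((h (x - Complex.I • y)).sub (h (x + Complex.I • y))).mul_right Complex.I)).div_const 4
    using 2 with i
  rw [← inner_conj_symm x (e i), mul_comm, ← RCLike.inner_apply, inner_eq_sum_norm_sq_div_four]
  simp only [inner_add_right, inner_sub_right, inner_smul_right, smul_eq_mul]
  rfl

/-- For a Parseval frame `e`, the series `∑ i, ⟪x, e i⟫ ⟪e i, y⟫` converges absolutely. -/
theorem summable_norm_inner_mul_inner_of_parseval {E ι : Type*} [NormedAddCommGroup E]
    [InnerProductSpace ℂ E] {e : ι → E}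
    (he : ∀ f : E, HasSum (fun i => ‖(⟪e i, f⟫ : ℂ)‖ ^ 2) (‖f‖ ^ 2)) (x y : E) :
    Summable (fun i => ‖(⟪x, e i⟫ : ℂ) * ⟪e i, y⟫‖) := by
  refine .of_nonneg_of_le (fun _ => norm_nonneg _) (fun i => ?_)
    ((he x).summable.add (he y).summable)
  rw [norm_mul, norm_inner_symm]
  nlinarith [sq_nonneg (‖(⟪e i, x⟫ : ℂ)‖ - ‖(⟪e i, y⟫ : ℂ)‖),
    sq_nonneg ‖(⟪e i, x⟫ : ℂ)‖, sq_nonneg ‖(⟪e i, y⟫ : ℂ)‖]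

/-- Monomials on the torus, evaluated at the image of a point of `ℝ^d`. -/
theorem mFourier_neg_coe {d : ℕ} (k : Fin d → ℤ) (x : Fin d → ℝ) :
    UnitAddTorus.mFourier (-k) (fun i => (x i : UnitAddCircle)) =
      Complex.exp (-Complex.I * ((2 * Real.pi * dotR (zToR k) x : ℝ) : ℂ)) := by
  simp only [UnitAddTorus.mFourier, ContinuousMap.coe_mk, Pi.neg_apply, fourier_coe_apply,
    ← Complex.exp_sum, dotR, zToR]
  congr 1
  push_cast
  rw [Finset.mul_sum, Finset.mul_sum]
  refine Finset.sum_congr rfl fun i _ => ?_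
  ring

/-- Parseval's identity for an `L²` function on `ℝ^d` supported in the unit cube. -/
theorem hasSum_sq_fourier_of_support_subset_unit_cube {d : ℕ} {H : (Fin d → ℝ) → ℂ}
    (hH : MemLp H 2 volume)
    (hsupp : ∀ x, (¬ ∀ i, x i ∈ Set.Ioc (-(1 / 2) : ℝ) (-(1 / 2) + 1)) → H x = 0) :
    HasSum (fun k : Fin d → ℤ =>
      ‖∫ x, Complex.exp (-Complex.I * ((2 * Real.pi * dotR (zToR k) x : ℝ) : ℂ)) * H x‖ ^ 2)
      (∫ x, ‖H x‖ ^ 2) := by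
  let _ : MeasureSpace UnitAddCircle := ⟨AddCircle.haarAddCircle⟩
  set b : Fin d → ℝ := fun _ => -(1 / 2)
  set F : UnitAddTorus (Fin d) → ℂ := fun t => H (UnitAddTorus.measurableEquivPiIoc b t).1 with hF
  set S : Set (Fin d → ℝ) := {x | ∀ i, x i ∈ Set.Ioc (b i) (b i + 1)}
  have hSm : MeasurableSet S := MeasurableSet.univ_pi' fun i => measurableSet_Ioc
  have hFmem : MemLp F 2 volume :=
    (hH.restrict S).comp_measurePreserving
      ((measurePreserving_subtype_coe hSm).comp (UnitAddTorus.measurePreserving_equivPiIoc b))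
  have hFcoe (x : Fin d → ℝ) (hx : x ∈ S) : F (fun i => (x i : UnitAddCircle)) = H x := by
    simp only [hF]
    congr 1
    exact congrArg Subtype.val ((UnitAddTorus.measurableEquivPiIoc b).apply_symm_apply ⟨x, hx⟩)
  have hae := hFmem.coeFn_toLp
  have key := UnitAddTorus.hasSum_sq_mFourierCoeff (hFmem.toLp F)
  have hnorm : ∫ t, ‖hFmem.toLp F t‖ ^ 2 = ∫ x, ‖H x‖ ^ 2 := by
    rw [integral_congr_ae (g := fun t => ‖F t‖ ^ 2) (hae.mono fun t ht => by simp only [ht])]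
    refine (UnitAddTorus.integral_preimage _ b).trans ?_
    rw [setIntegral_congr_fun (g := fun x => ‖H x‖ ^ 2) hSm
      (fun x hx => by simp only [hFcoe x hx])]
    exact setIntegral_eq_integral_of_forall_compl_eq_zero fun x hx => by simp [hsupp x hx]
  have hcoef (k : Fin d → ℤ) : UnitAddTorus.mFourierCoeff (hFmem.toLp F) k =
      ∫ x, Complex.exp (-Complex.I * ((2 * Real.pi * dotR (zToR k) x : ℝ) : ℂ)) * H x := by
    have h1 : UnitAddTorus.mFourierCoeff (hFmem.toLp F) k = UnitAddTorus.mFourierCoeff F k :=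
      integral_congr_ae (hae.mono fun t ht => by simp only [ht])
    rw [h1, UnitAddTorus.mFourierCoeff_eq_integral F k b]
    rw [setIntegral_congr_fun hSm (g := fun x =>
      Complex.exp (-Complex.I * ((2 * Real.pi * dotR (zToR k) x : ℝ) : ℂ)) * H x)
      (fun x hx => by
        simp only [hFcoe x hx]
        rw [mFourier_neg_coe, smul_eq_mul])]
    exact setIntegral_eq_integral_of_forall_compl_eq_zero fun x hx => by simp [hsupp x hx]
  rw [hnorm] at key
  simpa only [hcoef] using key

/-- Parseval's identity for an `L²` function on `ℝ^d` supported in the cube `(-π, π]^d`. -/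
theorem hasSum_sq_fourier_of_support_subset_cube {d : ℕ} {h : (Fin d → ℝ) → ℂ}
    (hh : MemLp h 2 volume)
    (hsupp : ∀ x, (¬ ∀ i, x i ∈ Set.Ioc (-Real.pi) Real.pi) → h x = 0) :
    HasSum (fun k : Fin d → ℤ =>
      ‖∫ x, Complex.exp (-Complex.I * (dotR (zToR k) x : ℂ)) * h x‖ ^ 2)
      ((2 * Real.pi) ^ d * ∫ x, ‖h x‖ ^ 2) := by
  have hpi := Real.pi_pos
  set c : ℝ := 2 * Real.pi with hc
  have hc0 : 0 < c := by positivity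
  have hH : MemLp (fun y => h (c • y)) 2 volume := by
    have hm : Measure.map (fun y : Fin d → ℝ => c • y) volume =
        ENNReal.ofReal |(c ^ Module.finrank ℝ (Fin d → ℝ))⁻¹| • volume :=
      Measure.map_addHaar_smul volume hc0.ne'
    refine MemLp.comp_of_map (f := fun y : Fin d → ℝ => c • y) ?_
      (measurable_const_smul c).aemeasurable
    rw [hm]
    exact hh.smul_measure ENNReal.ofReal_ne_top
  have key := hasSum_sq_fourier_of_support_subset_unit_cube hH (fun x hx => hsupp _ fun hx' =>
    hx fun i => by
      have := hx' i
      simp only [Pi.smul_apply, smul_eq_mul, Set.mem_Ioc, hc] at this ⊢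
      constructor <;> nlinarith)
  have habs : |(c ^ d)⁻¹| = (c ^ d)⁻¹ := abs_of_pos (by positivity)
  have hdot (k : Fin d → ℤ) (x : Fin d → ℝ) :
      c * dotR (zToR k) x = dotR (zToR k) (c • x) := by
    simp only [dotR, Finset.mul_sum, Pi.smul_apply, smul_eq_mul]
    exact Finset.sum_congr rfl fun i _ => by ring
  have hint (k : Fin d → ℤ) :
      ∫ x, Complex.exp (-Complex.I * ((c * dotR (zToR k) x : ℝ) : ℂ)) * h (c • x) =
        (c ^ d)⁻¹ • ∫ x, Complex.exp (-Complex.I * (dotR (zToR k) x : ℂ)) * h x := by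
    simp only [hdot]
    rw [Measure.integral_comp_smul volume
      (fun x => Complex.exp (-Complex.I * (dotR (zToR k) x : ℂ)) * h x) c]
    simp [habs]
  have hn : ∫ x, ‖h (c • x)‖ ^ 2 = (c ^ d)⁻¹ • ∫ x, ‖h x‖ ^ 2 := by
    rw [Measure.integral_comp_smul volume (fun x => ‖h x‖ ^ 2) c]
    simp [habs]
  simp only [← hc, hint, hn, norm_smul, mul_pow] at key
  have := key.mul_left ((c ^ d) ^ 2)
  have hcd : c ^ d ≠ 0 := by positivity
  convert! this using 1
  · funext k
    rw [Real.norm_eq_abs, habs]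
    field_simp
  · rw [smul_eq_mul]
    field_simp

/-- The modulus of a Gabor function. -/
theorem norm_gaborF {d : ℕ} {A : (Fin d → ℝ) → (Fin d → ℝ)} {g : (Fin d → ℝ) → ℝ}
    (hg : IsQuadPartition g) (γ k : Fin d → ℤ) (x : Fin d → ℝ) :
    ‖gaborF A g γ k x‖ = (2 * Real.pi) ^ (-(d : ℝ) / 2) * g (x - zToR γ) := by
  have h1 (r : ℝ) : ‖Complex.exp (Complex.I * (r : ℂ))‖ = 1 := by
    rw [mul_comm, Complex.norm_exp_ofReal_mul_I]
  have h2 (r : ℝ) : ‖Complex.exp (-Complex.I * (r : ℂ))‖ = 1 := by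
    simpa using h1 (-r)
  have hpos : (0 : ℝ) ≤ (2 * Real.pi) ^ (-(d : ℝ) / 2) := by positivity
  simp only [gaborF, magPhase, norm_mul, h1, h2, Complex.norm_real, one_mul, mul_one,
    Real.norm_of_nonneg hpos, Real.norm_of_nonneg (hg.2.1 _).1]

/-- Gabor functions at the same lattice point differ by a plane wave. -/
theorem gaborF_eq_gaborF_zero_mul {d : ℕ} (A : (Fin d → ℝ) → (Fin d → ℝ))
    (g : (Fin d → ℝ) → ℝ) (γ k : Fin d → ℤ) (x : Fin d → ℝ) :
    gaborF A g γ k x =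
      gaborF A g γ 0 x * Complex.exp (Complex.I * (dotR (zToR k) (x - zToR γ) : ℂ)) := by
  have h0 : dotR (dualV (0 : Fin d → ℤ)) (x - zToR γ) / (2 * Real.pi) = 0 := by
    simp [dotR, dualV]
  have hk : dotR (dualV k) (x - zToR γ) / (2 * Real.pi) = dotR (zToR k) (x - zToR γ) := by
    have : (2 * Real.pi) ≠ 0 := by positivity
    rw [div_eq_iff this]
    simp only [dotR, dualV, zToR, Finset.sum_mul]
    exact Finset.sum_congr rfl fun i _ => by ring
  simp only [gaborF, h0, hk, Complex.ofReal_zero, mul_zero, Complex.exp_zero, mul_one]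
  ring

/-- Parseval's identity for the Gabor functions attached to a single lattice point. -/
theorem hasSum_sq_inner_gabor_fiber {d : ℕ} {A : (Fin d → ℝ) → (Fin d → ℝ)}
    {g : (Fin d → ℝ) → ℝ} (hg : IsQuadPartition g)
    {e : ((Fin d → ℤ) × (Fin d → ℤ)) → Lp ℂ 2 (volume : Measure (Fin d → ℝ))}
    (he : ∀ γ k, e (γ, k) =ᵐ[volume] gaborF A g γ k)
    (f : Lp ℂ 2 (volume : Measure (Fin d → ℝ))) (γ : Fin d → ℤ) :
    HasSum (fun k => ‖(⟪e (γ, k), f⟫ : ℂ)‖ ^ 2) (∫ x, g (x - zToR γ) ^ 2 * ‖f x‖ ^ 2) := by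
  have hpi := Real.pi_pos
  set c : ℝ := (2 * Real.pi) ^ (-(d : ℝ) / 2) with hc
  have hcpos : 0 < c := by positivity
  have hcd : (2 * Real.pi) ^ d * c ^ 2 = 1 := by
    rw [hc, ← Real.rpow_natCast, ← Real.rpow_natCast, ← Real.rpow_mul (by positivity),
      ← Real.rpow_add (by positivity)]
    norm_num
  set h₀ : (Fin d → ℝ) → ℂ := fun x => conj (gaborF A g γ 0 x) * f x with hh₀
  have hnorm (x : Fin d → ℝ) : ‖h₀ x‖ = c * g (x - zToR γ) * ‖f x‖ := by
    rw [hh₀, norm_mul, RCLike.norm_conj, norm_gaborF hg]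
  have hmeas : AEStronglyMeasurable (gaborF A g γ 0) volume :=
    (Lp.aestronglyMeasurable _).congr (he γ 0)
  have hmem₀ : MemLp h₀ 2 volume := by
    refine (Lp.memLp f).of_le_mul (c := c)
      ((Complex.continuous_conj.comp_aestronglyMeasurable hmeas).mul
        (Lp.aestronglyMeasurable f)) (.of_forall fun x => ?_)
    rw [hnorm]
    have := (hg.2.1 (x - zToR γ)).2
    gcongr
    nlinarith
  have hmem : MemLp (fun x => h₀ (x + zToR γ)) 2 volume :=
    hmem₀.comp_measurePreserving (measurePreserving_add_right volume (zToR γ))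
  have key := hasSum_sq_fourier_of_support_subset_cube hmem fun x hx => by
    rw [← norm_eq_zero, hnorm, add_sub_cancel_right]
    have hgx : g x = 0 := by
      by_contra hne
      refine hx fun i => ?_
      have := hg.2.2.1 (subset_tsupport g hne) i (Set.mem_univ i)
      have h3 := Real.pi_gt_three
      constructor <;> linarith [this.1, this.2]
    simp [hgx]
  have hinner (k : Fin d → ℤ) :
      ∫ x, Complex.exp (-Complex.I * (dotR (zToR k) x : ℂ)) * h₀ (x + zToR γ) =
        (⟪e (γ, k), f⟫ : ℂ) := by
    have htr := integral_add_right_eq_self (μ := (volume : Measure (Fin d → ℝ)))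
      (fun x => Complex.exp (-Complex.I * (dotR (zToR k) (x - zToR γ) : ℂ)) * h₀ x) (zToR γ)
    simp only [add_sub_cancel_right] at htr
    rw [htr, L2.inner_def]
    refine integral_congr_ae ((he γ k).mono fun x hx => ?_)
    simp only [hx]
    rw [gaborF_eq_gaborF_zero_mul, RCLike.inner_apply, map_mul, ← Complex.exp_conj, map_mul,
      Complex.conj_I, Complex.conj_ofReal]
    ring
  simp only [hinner] at key
  convert! key using 1
  rw [integral_add_right_eq_self (μ := (volume : Measure (Fin d → ℝ)))
    (fun x => ‖h₀ x‖ ^ 2) (zToR γ), ← integral_const_mul]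
  refine integral_congr_ae (.of_forall fun x => ?_)
  simp only [hnorm]
  linear_combination (-(g (x - zToR γ) ^ 2 * ‖f x‖ ^ 2)) * hcd

/-- The magnetic Gabor functions form a Parseval frame of `L²(ℝ^d)`. -/
theorem hasSum_sq_inner_gabor {d : ℕ} {A : (Fin d → ℝ) → (Fin d → ℝ)}
    {g : (Fin d → ℝ) → ℝ} (hg : IsQuadPartition g)
    {e : ((Fin d → ℤ) × (Fin d → ℤ)) → Lp ℂ 2 (volume : Measure (Fin d → ℝ))}
    (he : ∀ γ k, e (γ, k) =ᵐ[volume] gaborF A g γ k)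
    (f : Lp ℂ 2 (volume : Measure (Fin d → ℝ))) :
    HasSum (fun i => ‖(⟪e i, f⟫ : ℂ)‖ ^ 2) (‖f‖ ^ 2) := by
  have hfint : Integrable (fun x => ‖f x‖ ^ 2) volume :=
    (Lp.memLp f).integrable_norm_pow two_ne_zero
  have hsum (x : Fin d → ℝ) :
      HasSum (fun γ => g (x - zToR γ) ^ 2 * ‖f x‖ ^ 2) (‖f x‖ ^ 2) := by
    simpa using (hg.2.2.2 x).mul_right (‖f x‖ ^ 2)
  have hf : ‖f‖ ^ 2 = ∫ x, ‖f x‖ ^ 2 := by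
    rw [← inner_self_eq_norm_sq (𝕜 := ℂ) f, L2.inner_def, ← integral_re (L2.integrable_inner f f)]
    simp only [inner_self_eq_norm_sq]
  have hγ : HasSum (fun γ => ∫ x, g (x - zToR γ) ^ 2 * ‖f x‖ ^ 2) (‖f‖ ^ 2) := by
    rw [hf]
    have hcont := hg.1.continuous
    refine hasSum_integral_of_dominated_convergence
      (fun γ x => g (x - zToR γ) ^ 2 * ‖f x‖ ^ 2) (fun γ => ?_)
      (fun γ => .of_forall fun x => ?_) (.of_forall fun x => (hsum x).summable) ?_
      (.of_forall hsum)
    · exact Continuous.aestronglyMeasurable (by fun_prop) |>.mul hfint.aestronglyMeasurable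
    · exact (Real.norm_of_nonneg (by positivity)).le
    · simpa only [(hsum _).tsum_eq] using hfint
  have hfib := hasSum_sq_inner_gabor_fiber hg he f
  have hs : Summable fun i => ‖(⟪e i, f⟫ : ℂ)‖ ^ 2 := by
    refine (summable_prod_of_nonneg fun _ => by positivity).mpr
      ⟨fun γ => (hfib γ).summable, ?_⟩
    simpa only [(hfib _).tsum_eq] using hγ.summable
  have htot := hs.hasSum
  rwa [(htot.prod_fiberwise hfib).unique hγ] at htot

/-- **Gabor matrix of a composition** (Proposition 3.4, operator form): for linear maps
`T₁, T₂ : 𝓢(ℝ^d) → L²(ℝ^d)` whose matrix coefficients against Schwartz functions are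
`L²`-bounded, and with `u aa = T₁* G^A_{aa}` the Riesz representatives (assumed as a
hypothesis characterizing them), the series
`∑_{cc} (G^A_{aa}, T₁ G^A_{cc}) (G^A_{cc}, T₂ G^A_{bb})` converges absolutely and equals
`(T₁* G^A_{aa}, T₂ G^A_{bb})_{L²}`, the Gabor matrix element of the composition. -/
theorem gabor_matrix_of_composition (d : ℕ) (hd : 1 ≤ d)
    (A : (Fin d → ℝ) → (Fin d → ℝ)) (hA : Function.HasTemperateGrowth A)
    (g : (Fin d → ℝ) → ℝ) (hg : IsQuadPartition g)
    (Gs : ((Fin d → ℤ) × (Fin d → ℤ)) → SchwartzMap (Fin d → ℝ) ℂ)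
    (hGs : ∀ γ k : Fin d → ℤ, ∀ x, Gs (γ, k) x = gaborF A g γ k x)
    (toL2 : SchwartzMap (Fin d → ℝ) ℂ →ₗ[ℂ] Lp ℂ 2 (volume : Measure (Fin d → ℝ)))
    (htoL2 : ∀ ψ : SchwartzMap (Fin d → ℝ) ℂ,
      (toL2 ψ : (Fin d → ℝ) → ℂ) =ᵐ[volume] fun x => ψ x)
    (T₁ T₂ : SchwartzMap (Fin d → ℝ) ℂ →ₗ[ℂ] Lp ℂ 2 (volume : Measure (Fin d → ℝ)))
    (hT₁ : ∀ v : SchwartzMap (Fin d → ℝ) ℂ, ∃ C : ℝ,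
      ∀ ψ : SchwartzMap (Fin d → ℝ) ℂ, ‖(⟪toL2 v, T₁ ψ⟫ : ℂ)‖ ≤ C * ‖toL2 ψ‖)
    (hT₂ : ∀ v : SchwartzMap (Fin d → ℝ) ℂ, ∃ C : ℝ,
      ∀ ψ : SchwartzMap (Fin d → ℝ) ℂ, ‖(⟪toL2 v, T₂ ψ⟫ : ℂ)‖ ≤ C * ‖toL2 ψ‖)
    (u : ((Fin d → ℤ) × (Fin d → ℤ)) → Lp ℂ 2 (volume : Measure (Fin d → ℝ)))
    (hu : ∀ aa : (Fin d → ℤ) × (Fin d → ℤ), ∀ ψ : SchwartzMap (Fin d → ℝ) ℂ,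
      (⟪u aa, toL2 ψ⟫ : ℂ) = (⟪toL2 (Gs aa), T₁ ψ⟫ : ℂ)) :
    ∀ aa bb : (Fin d → ℤ) × (Fin d → ℤ),
      Summable (fun cc : (Fin d → ℤ) × (Fin d → ℤ) =>
        ‖(⟪toL2 (Gs aa), T₁ (Gs cc)⟫ : ℂ) * (⟪toL2 (Gs cc), T₂ (Gs bb)⟫ : ℂ)‖) ∧
      (∑' cc : (Fin d → ℤ) × (Fin d → ℤ),
          (⟪toL2 (Gs aa), T₁ (Gs cc)⟫ : ℂ) * (⟪toL2 (Gs cc), T₂ (Gs bb)⟫ : ℂ)) =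
        (⟪u aa, T₂ (Gs bb)⟫ : ℂ) := by
  intro aa bb
  have hparseval := hasSum_sq_inner_gabor hg (e := fun i => toL2 (Gs i))
    fun γ k => (htoL2 (Gs (γ, k))).trans (.of_forall (hGs γ k))
  simp only [← hu]
  exact ⟨summable_norm_inner_mul_inner_of_parseval hparseval _ _,
    (hasSum_inner_mul_inner_of_parseval hparseval _ _).tsum_eq⟩
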